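/- arXiv:1401.7531 — 8 statements merged into one kernel-verified Lean document; each statement's English description precedes it below -/
import Mathlib

section
/- Let M be a Γ-semigroup. If M is left regular, then for every a ∈ M there exists ξ ∈ Γ such that L(a) ⊆ L(aξa). (This is the corrected form of the implication whose published proof, quantifying over all γ ∈ Γ, is erroneous.) -/
def Lset {M Γ : Type*} (mul : M → Γ → M → M) (a : M) : Set M :=
  {a} ∪ {t | ∃ (x : M) (γ : Γ), t = mul x γ a}

theorem stmt1 {M Γ : Type*} [Nonempty M] [Nonempty Γ]
    (mul : M → Γ → M → M)
    (assoc : ∀ (a b c : M) (γ μ : Γ),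
      mul (mul a γ b) μ c = mul a γ (mul b μ c))
    (h : ∀ a : M, ∃ (x : M) (γ μ : Γ), a = mul x γ (mul a μ a)) :
    ∀ a : M, ∃ ξ : Γ, Lset mul a ⊆ Lset mul (mul a ξ a) := by
  intro a
  obtain ⟨x, γ, μ, hx⟩ := h a
  refine ⟨μ, ?_⟩
  rintro t (ht | ⟨y, ν, ht⟩)
  · exact Or.inr ⟨x, γ, (Set.mem_singleton_iff.mp ht).trans hx⟩
  · refine Or.inr ⟨mul y ν x, γ, ?_⟩
    rw [assoc, ← hx]
    exact ht
end

section
/- Let M be a Γ-semigroup. Then M is left regular if and only if for every a ∈ M there exists γ ∈ Γ such that a and aγa are L-related (i.e., L(a) = L(aγa)). (This is the corrected version of Lemma 2.13 of Hila–Dine, in which the quantifier 'for every γ ∈ Γ' must be replaced by 'there exists γ ∈ Γ'.) -/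
theorem stmt3 {M Γ : Type*} [Nonempty M] [Nonempty Γ]
    (mul : M → Γ → M → M)
    (assoc : ∀ (a b c : M) (γ μ : Γ),
      mul (mul a γ b) μ c = mul a γ (mul b μ c))
    :
    (∀ a : M, ∃ (x : M) (γ μ : Γ), a = mul x γ (mul a μ a)) ↔ (∀ a : M, ∃ γ : Γ, Lset mul a = Lset mul (mul a γ a)) := by
  constructor
  · intro h a
    obtain ⟨x, γ, μ, hx⟩ := h a
    refine ⟨μ, Set.Subset.antisymm ?_ ?_⟩
    · rintro t (ht | ⟨y, δ, ht⟩)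
      · have ht' : t = a := ht
        exact Or.inr ⟨x, γ, ht'.trans hx⟩
      · refine Or.inr ⟨mul y δ x, γ, ?_⟩
        rw [assoc, ← hx]
        exact ht
    · rintro t (ht | ⟨y, δ, ht⟩)
      · exact Or.inr ⟨a, μ, ht⟩
      · refine Or.inr ⟨mul y δ a, μ, ?_⟩
        rw [assoc]
        exact ht
  · intro h a
    obtain ⟨γ, hγ⟩ := h a
    have ha : a ∈ Lset mul (mul a γ a) := by
      rw [← hγ]
      exact Or.inl rfl
    rcases ha with ha | ⟨x, δ, hx⟩
    · have ha' : a = mul a γ a := ha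
      exact ⟨a, γ, γ, by rw [← ha']; exact ha'⟩
    · exact ⟨x, δ, γ, hx⟩
end

section
/- Let M be a Γ-semigroup. If M is right regular, then for every a ∈ M there exists ξ ∈ Γ such that R(a) ⊆ R(aξa). (This is the corrected form of the implication whose published proof, quantifying over all γ ∈ Γ, is erroneous.) -/
def Rset {M Γ : Type*} (mul : M → Γ → M → M) (a : M) : Set M :=
  {a} ∪ {t | ∃ (x : M) (γ : Γ), t = mul a γ x}

theorem stmt6 {M Γ : Type*} [Nonempty M] [Nonempty Γ]
    (mul : M → Γ → M → M)
    (assoc : ∀ (a b c : M) (γ μ : Γ),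
      mul (mul a γ b) μ c = mul a γ (mul b μ c))
    (h : ∀ a : M, ∃ (x : M) (γ μ : Γ), a = mul (mul a γ a) μ x) :
    ∀ a : M, ∃ ξ : Γ, Rset mul a ⊆ Rset mul (mul a ξ a) := by
  intro a
  obtain ⟨x, γ, μ, hx⟩ := h a
  refine ⟨γ, ?_⟩
  rintro t (ht | ⟨y, ν, ht⟩)
  · right
    have ht' : t = a := ht
    exact ⟨x, μ, ht'.trans hx⟩
  · right
    refine ⟨mul x ν y, μ, ?_⟩
    rw [← assoc, ← hx]
    exact ht
end

section
/- Let M be a Γ-semigroup. Then M is right regular if and only if for every a ∈ M there exists γ ∈ Γ such that a and aγa are R-related (i.e., R(a) = R(aγa)). (This is the corrected version of Lemma 2.14 of Hila–Dine, in which the quantifier 'for every γ ∈ Γ' must be replaced by 'there exists γ ∈ Γ'.) -/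
theorem stmt8 {M Γ : Type*} [Nonempty M] [Nonempty Γ]
    (mul : M → Γ → M → M)
    (assoc : ∀ (a b c : M) (γ μ : Γ),
      mul (mul a γ b) μ c = mul a γ (mul b μ c))
    :
    (∀ a : M, ∃ (x : M) (γ μ : Γ), a = mul (mul a γ a) μ x) ↔ (∀ a : M, ∃ γ : Γ, Rset mul a = Rset mul (mul a γ a)) := by
  constructor
  · intro h a
    obtain ⟨x, γ, μ, hx⟩ := h a
    refine ⟨γ, Set.Subset.antisymm ?_ ?_⟩
    · rintro t (ht | ⟨y, ν, ht⟩)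
      · have ht' : t = a := ht
        exact Or.inr ⟨x, μ, ht'.trans hx⟩
      · refine Or.inr ⟨mul x ν y, μ, ?_⟩
        rw [← assoc, ← hx]
        exact ht
    · rintro t (ht | ⟨y, ν, ht⟩)
      · exact Or.inr ⟨a, γ, ht⟩
      · exact Or.inr ⟨mul a ν y, γ, by rw [← assoc]; exact ht⟩
  · intro h a
    obtain ⟨γ, hγ⟩ := h a
    have ha : a ∈ Rset mul (mul a γ a) := by
      rw [← hγ]
      exact Or.inl rfl
    rcases ha with ha | ⟨x, μ, hx⟩
    · have ha' : a = mul a γ a := ha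
      exact ⟨a, γ, γ, by rw [← ha', ← ha']⟩
    · exact ⟨x, γ, μ, hx⟩
end

section
/- Let M be a po-Γ-semigroup. If M is left regular, then for every a ∈ M there exists ξ ∈ Γ such that L(a) ⊆ L(aξa). (This is the corrected form of the implication (1) ⇒ (2) of Theorem 1 of Kwon–Lee, whose published proof wrongly reuses the same γ.) -/
def LsetPo {M Γ : Type*} [PartialOrder M] (mul : M → Γ → M → M) (a : M) : Set M :=
  {t | t ≤ a ∨ ∃ (x : M) (γ : Γ), t ≤ mul x γ a}

theorem stmt10 {M Γ : Type*} [Nonempty M] [Nonempty Γ] [PartialOrder M]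
    (mul : M → Γ → M → M)
    (assoc : ∀ (a b c : M) (γ μ : Γ),
      mul (mul a γ b) μ c = mul a γ (mul b μ c))
    (compat_left : ∀ (a b x : M) (γ : Γ), a ≤ b → mul x γ a ≤ mul x γ b)
    (compat_right : ∀ (a b x : M) (γ : Γ), a ≤ b → mul a γ x ≤ mul b γ x)
    (h : ∀ a : M, ∃ (x : M) (γ μ : Γ), a ≤ mul x γ (mul a μ a)) :
    ∀ a : M, ∃ ξ : Γ, LsetPo mul a ⊆ LsetPo mul (mul a ξ a) := by
  intro a
  obtain ⟨x, γ, μ, hx⟩ := h a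
  refine ⟨μ, ?_⟩
  rintro t (ht | ⟨y, ρ, ht⟩)
  · exact Or.inr ⟨x, γ, ht.trans hx⟩
  · refine Or.inr ⟨mul y ρ x, γ, ?_⟩
    rw [assoc]
    exact ht.trans (compat_left _ _ _ _ hx)
end

section
/- Let M be a po-Γ-semigroup. Then M is left regular if and only if for every a ∈ M there exists γ ∈ Γ such that a and aγa are L-related (i.e., L(a) = L(aγa)). (This is the corrected version of Theorem 1 of Kwon–Lee, in which the quantifier 'for every γ ∈ Γ' must be replaced by 'there exists γ ∈ Γ'.) -/
theorem stmt11 {M Γ : Type*} [Nonempty M] [Nonempty Γ] [PartialOrder M]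
    (mul : M → Γ → M → M)
    (assoc : ∀ (a b c : M) (γ μ : Γ),
      mul (mul a γ b) μ c = mul a γ (mul b μ c))
    (compat_left : ∀ (a b x : M) (γ : Γ), a ≤ b → mul x γ a ≤ mul x γ b)
    (compat_right : ∀ (a b x : M) (γ : Γ), a ≤ b → mul a γ x ≤ mul b γ x)
    :
    (∀ a : M, ∃ (x : M) (γ μ : Γ), a ≤ mul x γ (mul a μ a)) ↔ (∀ a : M, ∃ γ : Γ, LsetPo mul a = LsetPo mul (mul a γ a)) := by
  constructor
  · intro h a
    obtain ⟨x, γ, μ, hx⟩ := h a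
    refine ⟨μ, Set.ext fun t => ⟨?_, ?_⟩⟩
    · rintro (ht | ⟨y, δ, ht⟩)
      · exact Or.inr ⟨x, γ, ht.trans hx⟩
      · refine Or.inr ⟨mul y δ x, γ, ?_⟩
        rw [assoc]
        exact ht.trans (compat_left _ _ _ _ hx)
    · rintro (ht | ⟨y, δ, ht⟩)
      · exact Or.inr ⟨a, μ, ht⟩
      · refine Or.inr ⟨mul y δ a, μ, ?_⟩
        rw [assoc]
        exact ht
  · intro h a
    obtain ⟨γ, hγ⟩ := h a
    have ha : a ∈ LsetPo mul (mul a γ a) := hγ ▸ (Or.inl le_rfl : a ∈ LsetPo mul a)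
    rcases ha with ha | ⟨x, μ, ha⟩
    · exact ⟨a, γ, γ, ha.trans (compat_left _ _ _ _ ha)⟩
    · exact ⟨x, μ, γ, ha⟩
end

section
/- Let M be a po-Γ-semigroup. If L(a) ⊆ L(aγa) for every a ∈ M and every γ ∈ Γ, then M is left regular. -/
theorem stmt12 {M Γ : Type*} [Nonempty M] [Nonempty Γ] [PartialOrder M]
    (mul : M → Γ → M → M)
    (assoc : ∀ (a b c : M) (γ μ : Γ),
      mul (mul a γ b) μ c = mul a γ (mul b μ c))
    (compat_left : ∀ (a b x : M) (γ : Γ), a ≤ b → mul x γ a ≤ mul x γ b)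
    (compat_right : ∀ (a b x : M) (γ : Γ), a ≤ b → mul a γ x ≤ mul b γ x)
    (h : ∀ (a : M) (γ : Γ), LsetPo mul a ⊆ LsetPo mul (mul a γ a)) :
    ∀ a : M, ∃ (x : M) (γ μ : Γ), a ≤ mul x γ (mul a μ a) := by
  intro a
  obtain ⟨g⟩ := ‹Nonempty Γ›
  rcases h a g (Or.inl le_rfl) with h1 | ⟨x, γ, h1⟩
  · exact ⟨a, g, g, h1.trans (compat_left _ _ a g h1)⟩
  · exact ⟨x, γ, g, h1⟩
end

section
/- Let M be a po-Γ-semigroup. Then M is right regular if and only if for every a ∈ M there exists γ ∈ Γ such that a and aγa are R-related (i.e., R(a) = R(aγa)). -/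
def RsetPo {M Γ : Type*} [PartialOrder M] (mul : M → Γ → M → M) (a : M) : Set M :=
  {t | t ≤ a ∨ ∃ (x : M) (γ : Γ), t ≤ mul a γ x}

theorem stmt14 {M Γ : Type*} [Nonempty M] [Nonempty Γ] [PartialOrder M]
    (mul : M → Γ → M → M)
    (assoc : ∀ (a b c : M) (γ μ : Γ),
      mul (mul a γ b) μ c = mul a γ (mul b μ c))
    (compat_left : ∀ (a b x : M) (γ : Γ), a ≤ b → mul x γ a ≤ mul x γ b)
    (compat_right : ∀ (a b x : M) (γ : Γ), a ≤ b → mul a γ x ≤ mul b γ x)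
    :
    (∀ a : M, ∃ (x : M) (γ μ : Γ), a ≤ mul (mul a γ a) μ x) ↔ (∀ a : M, ∃ γ : Γ, RsetPo mul a = RsetPo mul (mul a γ a)) := by
  constructor
  · intro h a
    obtain ⟨x, γ, μ, hx⟩ := h a
    refine ⟨γ, ?_⟩
    ext t
    constructor
    · rintro (ht | ⟨y, ν, ht⟩)
      · exact Or.inr ⟨x, μ, ht.trans hx⟩
      · refine Or.inr ⟨mul x ν y, μ, ht.trans ?_⟩
        rw [← assoc]
        exact compat_right _ _ _ _ hx
    · rintro (ht | ⟨y, ν, ht⟩)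
      · exact Or.inr ⟨a, γ, ht⟩
      · exact Or.inr ⟨mul a ν y, γ, by rw [← assoc]; exact ht⟩
  · intro h a
    obtain ⟨γ, hγ⟩ := h a
    have ha : a ∈ RsetPo mul (mul a γ a) := hγ ▸ (Or.inl le_rfl : a ∈ RsetPo mul a)
    rcases ha with ha | ⟨x, μ, ha⟩
    · exact ⟨a, γ, γ, ha.trans (compat_right _ _ _ _ ha)⟩
    · exact ⟨x, γ, μ, ha⟩
end
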